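/- Let F = (f_x, f_y, f_z) ∈ ℝ³ with f_z < g, let m > 0, define 𝒯 = m‖g z_I − F‖ where z_I = (0,0,1), and define q_{d0} = √(m(g − f_z)/(2𝒯) + ½), q_d = (m f_y/(2𝒯 q_{d0}), −m f_x/(2𝒯 q_{d0}), 0). Then 𝒯 > 0, q_{d0} is well-defined and positive, and Q_d = (q_d, q_{d0}) is a unit quaternion: ‖q_d‖² + q_{d0}² = 1. -/

import Mathlib

theorem thrust_extraction_unit_quaternion
    (g m fx fy fz : ℝ) (hg : 0 < g) (hm : 0 < m) (hfz : fz < g)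
    (T : ℝ) (hT : T = m * Real.sqrt (fx ^ 2 + fy ^ 2 + (g - fz) ^ 2))
    (qd0 : ℝ) (hqd0 : qd0 = Real.sqrt (m * (g - fz) / (2 * T) + 1 / 2))
    (qd : Fin 3 → ℝ)
    (hqd : qd = ![m * fy / (2 * T * qd0), -(m * fx) / (2 * T * qd0), 0]) :
    0 < T ∧ 0 < qd0 ∧ qd 0 ^ 2 + qd 1 ^ 2 + qd 2 ^ 2 + qd0 ^ 2 = 1 := by
  have hd : 0 < g - fz := sub_pos.mpr hfz
  have hTpos : 0 < T := by rw [hT]; positivity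
  have hqpos : 0 < qd0 := by rw [hqd0]; positivity
  refine ⟨hTpos, hqpos, ?_⟩
  have hT2 : T ^ 2 = m ^ 2 * (fx ^ 2 + fy ^ 2 + (g - fz) ^ 2) := by
    rw [hT, mul_pow, Real.sq_sqrt (by positivity)]
  have hq2 : qd0 ^ 2 = m * (g - fz) / (2 * T) + 1 / 2 := by
    rw [hqd0, Real.sq_sqrt (by positivity)]
  have ha : m * (g - fz) = T * (2 * qd0 ^ 2 - 1) := by
    rw [hq2]; field_simp; ring
  have key : m ^ 2 * (fx ^ 2 + fy ^ 2) = (2 * T * qd0) ^ 2 * (1 - qd0 ^ 2) := by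
    have h : m ^ 2 * (fx ^ 2 + fy ^ 2) = T ^ 2 - (m * (g - fz)) ^ 2 := by
      rw [hT2]; ring
    rw [h, ha]; ring
  have h0 : qd 0 = m * fy / (2 * T * qd0) := by rw [hqd]; rfl
  have h1 : qd 1 = -(m * fx) / (2 * T * qd0) := by rw [hqd]; rfl
  have h2 : qd 2 = 0 := by rw [hqd]; rfl
  have hne : (2 * T * qd0) ^ 2 ≠ 0 := by positivity
  have hs : (m * fy / (2 * T * qd0)) ^ 2 + (-(m * fx) / (2 * T * qd0)) ^ 2
      = 1 - qd0 ^ 2 := by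
    rw [div_pow, div_pow, ← add_div, div_eq_iff hne]
    linarith [key]
  rw [h0, h1, h2, hs]; ring
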